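/- arXiv:1201.3785 — 5 statements merged into one kernel-verified Lean document; each statement's English description precedes it below -/
import Mathlib

section
/- Fix an integer k with 1 ≤ k ≤ g−1. The map sending a quadruple (τ′, Z, A, B), with τ′ ∈ 𝔥_{g−k}, Z ∈ 𝔥_k, and A, B real (g−k)×k matrices, to the block matrix τ = [[τ′, A − τ′B],[(A − τ′B)ᵀ, Z + Bᵀτ′B − (AᵀB + BᵀA)/2]] is a bijection onto 𝔥_g. Moreover, for such τ one has Im(τ) = [[Im τ′, −(Im τ′)B],[−Bᵀ Im τ′, Im Z + Bᵀ(Im τ′)B]] and det Im(τ) = det Im(τ′) · det Im(Z). -/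
open Matrix

/-- The Siegel upper half space on an arbitrary finite index type: complex symmetric
matrices whose imaginary part is positive definite. -/
def SiegelHalfI (ι : Type*) [Fintype ι] [DecidableEq ι] : Set (Matrix ι ι ℂ) :=
  {τ | τ.IsSymm ∧ (τ.map Complex.im).PosDef}

/-- The gluing map `(τ', Z, A, B) ↦ τ` of Statement 1, written with blocks for the
decomposition `g = (g-k) + k`. -/
noncomputable def siegelGlue (g k : ℕ)
    (p : Matrix (Fin (g - k)) (Fin (g - k)) ℂ × Matrix (Fin k) (Fin k) ℂ ×
         Matrix (Fin (g - k)) (Fin k) ℝ × Matrix (Fin (g - k)) (Fin k) ℝ) :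
    Matrix (Fin (g - k) ⊕ Fin k) (Fin (g - k) ⊕ Fin k) ℂ :=
  Matrix.fromBlocks p.1
    (p.2.2.1.map (Complex.ofReal : ℝ → ℂ) - p.1 * p.2.2.2.map (Complex.ofReal : ℝ → ℂ))
    (p.2.2.1.map (Complex.ofReal : ℝ → ℂ) - p.1 * p.2.2.2.map (Complex.ofReal : ℝ → ℂ))ᵀ
    (p.2.1 + (p.2.2.2.map (Complex.ofReal : ℝ → ℂ))ᵀ * p.1 * p.2.2.2.map (Complex.ofReal : ℝ → ℂ)
      - (2⁻¹ : ℂ) • ((p.2.2.1.map (Complex.ofReal : ℝ → ℂ))ᵀ * p.2.2.2.map (Complex.ofReal : ℝ → ℂ)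
          + (p.2.2.2.map (Complex.ofReal : ℝ → ℂ))ᵀ * p.2.2.1.map (Complex.ofReal : ℝ → ℂ)))

namespace Matrix

variable {l m n : Type*} [Fintype m]

section PosDef

variable {R : Type*} [Fintype n] [CommRing R] [PartialOrder R] [StarRing R]

theorem PosDef.fromBlocks_zero [IsOrderedAddMonoid R]
    {X : Matrix m m R} {Y : Matrix n n R} (hX : X.PosDef) (hY : Y.PosDef) :
    (fromBlocks X 0 0 Y).PosDef := by
  refine .of_dotProduct_mulVec_pos (hX.isHermitian.fromBlocks (by simp) hY.isHermitian)
    fun x hx => ?_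
  rw [← Sum.elim_comp_inl_inr x, Function.star_sumElim, fromBlocks_mulVec]
  simp only [Sum.elim_comp_inl, Sum.elim_comp_inr, zero_mulVec, add_zero, zero_add,
    sumElim_dotProduct_sumElim]
  have hX' := hX.posSemidef.dotProduct_mulVec_nonneg (x ∘ Sum.inl)
  have hY' := hY.posSemidef.dotProduct_mulVec_nonneg (x ∘ Sum.inr)
  by_cases h : x ∘ Sum.inl = 0
  · refine add_pos_of_nonneg_of_pos hX' (hY.dotProduct_mulVec_pos fun h' => hx ?_)
    rw [← Sum.elim_comp_inl_inr x, h, h', Sum.elim_zero_zero]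
  · exact add_pos_of_pos_of_nonneg (hX.dotProduct_mulVec_pos h) hY'

theorem posDef_fromBlocks_zero_iff [IsOrderedAddMonoid R]
    {X : Matrix m m R} {Y : Matrix n n R} :
    (fromBlocks X 0 0 Y).PosDef ↔ X.PosDef ∧ Y.PosDef :=
  ⟨fun h => ⟨h.submatrix Sum.inl_injective, h.submatrix Sum.inr_injective⟩,
    fun h => h.1.fromBlocks_zero h.2⟩

end PosDef

section Congruence

variable {R : Type*} [Fintype n] [DecidableEq m] [DecidableEq n] [CommRing R]

theorem fromBlocks_neg_mul_eq_congr (X : Matrix m m R) (Y : Matrix n n R) (B : Matrix m n R) :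
    fromBlocks X (-(X * B)) (-(Bᵀ * X)) (Y + Bᵀ * X * B) =
      (fromBlocks 1 (-B) 0 1)ᵀ * fromBlocks X 0 0 Y * fromBlocks 1 (-B) 0 1 := by
  simp [fromBlocks_transpose, fromBlocks_multiply, add_comm]

theorem det_fromBlocks_neg_mul (X : Matrix m m R) (Y : Matrix n n R) (B : Matrix m n R) :
    (fromBlocks X (-(X * B)) (-(Bᵀ * X)) (Y + Bᵀ * X * B)).det = X.det * Y.det := by
  rw [fromBlocks_neg_mul_eq_congr]
  simp

theorem posDef_fromBlocks_neg_mul_iff [PartialOrder R] [IsOrderedAddMonoid R] [StarRing R]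
    [TrivialStar R] {X : Matrix m m R} {Y : Matrix n n R} {B : Matrix m n R} :
    (fromBlocks X (-(X * B)) (-(Bᵀ * X)) (Y + Bᵀ * X * B)).PosDef ↔ X.PosDef ∧ Y.PosDef := by
  have hU : IsUnit (fromBlocks 1 (-B) 0 1 : Matrix (m ⊕ n) (m ⊕ n) R) := by
    simp [isUnit_iff_isUnit_det]
  rw [fromBlocks_neg_mul_eq_congr, ← conjTranspose_eq_transpose_of_trivial,
    ← star_eq_conjTranspose, IsUnit.posDef_star_left_conjugate_iff hU, posDef_fromBlocks_zero_iff]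

end Congruence

theorem map_im_mul_map_ofReal (M : Matrix l m ℂ) (B : Matrix m n ℝ) :
    (M * B.map Complex.ofReal).map Complex.im = M.map Complex.im * B := by
  ext
  simp [mul_apply]

theorem map_im_map_ofReal_mul (B : Matrix l m ℝ) (M : Matrix m n ℂ) :
    (B.map Complex.ofReal * M).map Complex.im = B * M.map Complex.im := by
  ext
  simp [mul_apply]

theorem map_im_map_ofReal (B : Matrix l n ℝ) :
    (B.map Complex.ofReal).map Complex.im = 0 := by
  ext
  simp

theorem map_ofReal_re_sub_mul (w : Matrix l n ℂ) (T : Matrix l m ℂ) (B : Matrix m n ℝ)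
    (h : T.map Complex.im * B = -w.map Complex.im) :
    (w.map Complex.re + T.map Complex.re * B).map Complex.ofReal - T * B.map Complex.ofReal
      = w := by
  ext i j
  have hij := congrFun₂ h i j
  simp only [mul_apply, map_apply, neg_apply] at hij
  apply Complex.ext
  · simp [mul_apply]
  · simp [mul_apply, hij]

end Matrix

theorem siegelGlue_map_im {g k : ℕ}
    {p : Matrix (Fin (g - k)) (Fin (g - k)) ℂ × Matrix (Fin k) (Fin k) ℂ ×
         Matrix (Fin (g - k)) (Fin k) ℝ × Matrix (Fin (g - k)) (Fin k) ℝ}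
    (hp : p.1.IsSymm) :
    (siegelGlue g k p).map Complex.im =
      Matrix.fromBlocks (p.1.map Complex.im)
        (-(p.1.map Complex.im * p.2.2.2))
        (-(p.2.2.2ᵀ * p.1.map Complex.im))
        (p.2.1.map Complex.im + p.2.2.2ᵀ * p.1.map Complex.im * p.2.2.2) := by
  obtain ⟨T, Z, A, B⟩ := p
  have hAB : (A.map Complex.ofReal - T * B.map Complex.ofReal).map Complex.im
      = -(T.map Complex.im * B) := by
    rw [Matrix.map_sub _ Complex.sub_im, map_im_map_ofReal, map_im_mul_map_ofReal, zero_sub]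
  rw [siegelGlue, fromBlocks_map]
  congr 1
  · rw [transpose_map, hAB, transpose_neg, transpose_mul, (hp.map _).eq]
  · ext i j
    have h := congrFun₂ (map_im_mul_map_ofReal (Bᵀ.map Complex.ofReal * T) B) i j
    rw [map_im_map_ofReal_mul] at h
    rw [map_apply] at h
    simp [← transpose_map, h, mul_apply (N := A.map _), mul_apply (N := B.map _) (M := Aᵀ.map _)]

theorem isSymm_siegelGlue_iff {g k : ℕ}
    {p : Matrix (Fin (g - k)) (Fin (g - k)) ℂ × Matrix (Fin k) (Fin k) ℂ ×
         Matrix (Fin (g - k)) (Fin k) ℝ × Matrix (Fin (g - k)) (Fin k) ℝ} :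
    (siegelGlue g k p).IsSymm ↔ p.1.IsSymm ∧ p.2.1.IsSymm := by
  rw [siegelGlue, isSymm_fromBlocks_iff]
  simp only [transpose_transpose, true_and]
  refine and_congr_right fun h => ?_
  simp only [IsSymm, transpose_add, transpose_sub, transpose_smul, transpose_mul,
    transpose_transpose, h.eq, Matrix.mul_assoc]
  rw [add_comm (_ᵀ * _) (_ᵀ * _), sub_left_inj, add_left_inj]

theorem siegelGlue_mem_iff {g k : ℕ}
    {p : Matrix (Fin (g - k)) (Fin (g - k)) ℂ × Matrix (Fin k) (Fin k) ℂ ×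
         Matrix (Fin (g - k)) (Fin k) ℝ × Matrix (Fin (g - k)) (Fin k) ℝ} :
    siegelGlue g k p ∈ SiegelHalfI (Fin (g - k) ⊕ Fin k) ↔
      p.1 ∈ SiegelHalfI (Fin (g - k)) ∧ p.2.1 ∈ SiegelHalfI (Fin k) := by
  simp only [SiegelHalfI, Set.mem_ofPred_eq, isSymm_siegelGlue_iff]
  constructor
  · rintro ⟨⟨h₁, h₂⟩, h⟩
    rw [siegelGlue_map_im h₁, posDef_fromBlocks_neg_mul_iff] at h
    exact ⟨⟨h₁, h.1⟩, h₂, h.2⟩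
  · rintro ⟨⟨h₁, h₁'⟩, h₂, h₂'⟩
    rw [siegelGlue_map_im h₁, posDef_fromBlocks_neg_mul_iff]
    exact ⟨⟨h₁, h₂⟩, h₁', h₂'⟩

theorem injOn_siegelGlue (g k : ℕ) :
    Set.InjOn (siegelGlue g k) {p | p.1 ∈ SiegelHalfI (Fin (g - k))} := by
  rintro ⟨T, Z, A, B⟩ hT ⟨T', Z', A', B'⟩ - h
  obtain ⟨rfl, hw, -, hZ⟩ := fromBlocks_inj.mp h
  dsimp only at hw hZ
  have hB : B = B' := by
    have him := congrArg (fun M => M.map Complex.im) hw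
    simp only [Matrix.map_sub _ Complex.sub_im, map_im_map_ofReal, map_im_mul_map_ofReal,
      zero_sub, neg_inj] at him
    have hdet : IsUnit (T.map Complex.im).det := (isUnit_iff_isUnit_det _).mp hT.2.isUnit
    rw [← nonsing_inv_mul_cancel_left _ B hdet, him, nonsing_inv_mul_cancel_left _ _ hdet]
  subst hB
  have hA : A = A' := map_injective Complex.ofReal_injective (sub_left_injective hw)
  subst hA
  rw [sub_left_inj, add_left_inj] at hZ
  rw [hZ]

theorem siegelHalfI_subset_range_siegelGlue (g k : ℕ) :
    SiegelHalfI (Fin (g - k) ⊕ Fin k) ⊆ Set.range (siegelGlue g k) := by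
  rintro τ ⟨hs, hpos⟩
  have hY : (τ.toBlocks₁₁.map Complex.im).PosDef := hpos.submatrix Sum.inl_injective
  set T := τ.toBlocks₁₁
  set w := τ.toBlocks₁₂
  have hw : τ.toBlocks₂₁ = wᵀ := by
    ext i j
    exact hs.apply (Sum.inl j) (Sum.inr i)
  let B : Matrix (Fin (g - k)) (Fin k) ℝ := -((T.map Complex.im)⁻¹ * w.map Complex.im)
  let A := w.map Complex.re + T.map Complex.re * B
  have hAB : A.map Complex.ofReal - T * B.map Complex.ofReal = w := by
    refine map_ofReal_re_sub_mul w T B ?_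
    rw [Matrix.mul_neg, mul_nonsing_inv_cancel_left _ _
      ((isUnit_iff_isUnit_det _).mp hY.isUnit)]
  refine ⟨(T, τ.toBlocks₂₂ - (B.map Complex.ofReal)ᵀ * T * B.map Complex.ofReal
    + (2⁻¹ : ℂ) • ((A.map Complex.ofReal)ᵀ * B.map Complex.ofReal
      + (B.map Complex.ofReal)ᵀ * A.map Complex.ofReal), A, B), ?_⟩
  rw [siegelGlue]
  dsimp only
  rw [hAB, ← hw, add_right_comm, sub_add_cancel, add_sub_cancel_right, fromBlocks_toBlocks]

theorem statement1 (g k : ℕ) (hk1 : 1 ≤ k) (hk2 : k < g) :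
    Set.BijOn (siegelGlue g k)
      {p : Matrix (Fin (g - k)) (Fin (g - k)) ℂ × Matrix (Fin k) (Fin k) ℂ ×
           Matrix (Fin (g - k)) (Fin k) ℝ × Matrix (Fin (g - k)) (Fin k) ℝ |
        p.1 ∈ SiegelHalfI (Fin (g - k)) ∧ p.2.1 ∈ SiegelHalfI (Fin k)}
      (SiegelHalfI (Fin (g - k) ⊕ Fin k)) ∧
    ∀ p : Matrix (Fin (g - k)) (Fin (g - k)) ℂ × Matrix (Fin k) (Fin k) ℂ ×
          Matrix (Fin (g - k)) (Fin k) ℝ × Matrix (Fin (g - k)) (Fin k) ℝ,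
      p.1 ∈ SiegelHalfI (Fin (g - k)) → p.2.1 ∈ SiegelHalfI (Fin k) →
      ((siegelGlue g k p).map Complex.im =
        Matrix.fromBlocks (p.1.map Complex.im)
          (-(p.1.map Complex.im * p.2.2.2))
          (-(p.2.2.2ᵀ * p.1.map Complex.im))
          (p.2.1.map Complex.im + p.2.2.2ᵀ * p.1.map Complex.im * p.2.2.2)) ∧
      ((siegelGlue g k p).map Complex.im).det
        = (p.1.map Complex.im).det * (p.2.1.map Complex.im).det := by
  refine ⟨⟨fun p hp => siegelGlue_mem_iff.mpr hp, (injOn_siegelGlue g k).mono fun p hp => hp.1,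
    fun τ hτ => ?_⟩, fun p h₁ _ => ⟨siegelGlue_map_im h₁.1, ?_⟩⟩
  · obtain ⟨p, rfl⟩ := siegelHalfI_subset_range_siegelGlue g k hτ
    exact ⟨p, siegelGlue_mem_iff.mp hτ, rfl⟩
  · rw [siegelGlue_map_im h₁.1, det_fromBlocks_neg_mul]
end

section
/- Let F ∈ ℝ[x₁, …, x_N] and let k be an index with deg_{x_k} F ≥ 1. Set T_{ij} := F·F_{ij} − F_i·F_j, where F_i, F_{ij} denote partial derivatives. Then: (a) deg_{x_k} T_{kk} = 2·deg_{x_k}F − 2 (the degree is attained exactly); (b) deg_{x_k} T_{kj} ≤ 2·deg_{x_k}F − 1 and deg_{x_k} T_{jk} ≤ 2·deg_{x_k}F − 1 for every j ≠ k; (c) deg_{x_k} T_{ij} ≤ 2·deg_{x_k}F for i, j ≠ k; and (d) deg_{x_k} det((T_{ij})_{1≤i,j≤N}) ≤ 2N·deg_{x_k}F − 2. -/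
open MvPolynomial

namespace MvPolynomial

variable {σ R : Type*}

section CommSemiring

variable [CommSemiring R]

theorem coeff_X_mul_pderiv (k : σ) (p : MvPolynomial σ R) (m : σ →₀ ℕ) :
    coeff m (X k * pderiv k p) = m k * coeff m p := by
  classical
  induction p using MvPolynomial.induction_on' with
  | monomial u a =>
    rw [X_mul_pderiv_monomial, coeff_smul, coeff_monomial]
    split_ifs with h
    · simp [h]
    · simp
  | add p q hp hq => rw [map_add, mul_add, coeff_add, hp, hq, coeff_add, mul_add]

theorem degreeOf_pderiv_le (k j : σ) (p : MvPolynomial σ R) :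
    degreeOf k (pderiv j p) ≤ degreeOf k p := by
  refine degreeOf_le_iff.mpr fun m hm => ?_
  rw [mem_support_iff, coeff_pderiv] at hm
  have h := (degreeOf_le_iff (n := k)).mp le_rfl _ (mem_support_iff.mpr (left_ne_zero_of_mul hm))
  exact le_trans (by simp) h

theorem degreeOf_pderiv_self_le (k : σ) (p : MvPolynomial σ R) :
    degreeOf k (pderiv k p) ≤ degreeOf k p - 1 := by
  refine degreeOf_le_iff.mpr fun m hm => ?_
  rw [mem_support_iff, coeff_pderiv] at hm
  have h := (degreeOf_le_iff (n := k)).mp le_rfl _ (mem_support_iff.mpr (left_ne_zero_of_mul hm))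
  simp only [Finsupp.add_apply, Finsupp.single_eq_same] at h
  omega

theorem degreeOf_X_mul_pderiv_le (k : σ) (p : MvPolynomial σ R) :
    degreeOf k (X k * pderiv k p) ≤ degreeOf k p := by
  refine degreeOf_le_iff.mpr fun m hm => ?_
  rw [mem_support_iff, coeff_X_mul_pderiv] at hm
  exact degreeOf_le_iff.mp le_rfl _ (mem_support_iff.mpr (right_ne_zero_of_mul hm))

theorem pderiv_eq_zero_of_degreeOf_eq_zero {k : σ} {p : MvPolynomial σ R}
    (h : degreeOf k p = 0) : pderiv k p = 0 :=
  pderiv_eq_zero_of_notMem_vars fun hk => mem_vars_iff_degreeOf_ne_zero.mp hk h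

end CommSemiring

section CommRing

variable [CommRing R]

/-- If `f` has positive degree `d` in `x_k`, the Euler operator `x_k ∂_k` agrees with
multiplication by `d` up to terms of lower degree in `x_k`. -/
theorem degreeOf_X_mul_pderiv_sub_lt {k : σ} {f : MvPolynomial σ R} (h : 1 ≤ degreeOf k f) :
    degreeOf k (X k * pderiv k f - C (degreeOf k f : R) * f) < degreeOf k f := by
  refine (degreeOf_lt_iff h).mpr fun m hm => ?_
  rw [mem_support_iff, coeff_sub, coeff_X_mul_pderiv, coeff_C_mul, ← sub_mul] at hm
  have hle := (degreeOf_le_iff (n := k)).mp le_rfl _ (mem_support_iff.mpr (right_ne_zero_of_mul hm))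
  refine lt_of_le_of_ne hle fun he => left_ne_zero_of_mul hm ?_
  rw [he, sub_self]

theorem degreeOf_hessianLog_add_le [DecidableEq σ] {k : σ} {f : MvPolynomial σ R}
    (h : 1 ≤ degreeOf k f) (i j : σ) :
    degreeOf k (f * pderiv i (pderiv j f) - pderiv i f * pderiv j f)
      + ((if i = k then 1 else 0) + (if j = k then 1 else 0)) ≤ 2 * degreeOf k f := by
  have hs := degreeOf_sub_le k (f * pderiv i (pderiv j f)) (pderiv i f * pderiv j f)
  have h1 := degreeOf_mul_le k f (pderiv i (pderiv j f))
  have h2 := degreeOf_mul_le k (pderiv i f) (pderiv j f)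
  have hi := degreeOf_pderiv_le k i f
  have hj := degreeOf_pderiv_le k j f
  have hij := degreeOf_pderiv_le k i (pderiv j f)
  have hk := degreeOf_pderiv_self_le k f
  have hik := degreeOf_pderiv_self_le k (pderiv j f)
  split_ifs with hi' hj' hj'
  · subst hi' hj'
    by_cases h0 : degreeOf j (pderiv j f) = 0
    · rw [pderiv_eq_zero_of_degreeOf_eq_zero h0, mul_zero, degreeOf_zero] at hs
      rw [pderiv_eq_zero_of_degreeOf_eq_zero h0, mul_zero]
      omega
    · omega
  · subst hi'; omega
  · subst hj'; omega
  · omega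

theorem degreeOf_det_hessianLog_add_two_le [Fintype σ] [DecidableEq σ] {k : σ}
    {f : MvPolynomial σ R} (h : 1 ≤ degreeOf k f) :
    degreeOf k (Matrix.det (Matrix.of fun i j : σ =>
      f * pderiv i (pderiv j f) - pderiv i f * pderiv j f)) + 2
      ≤ 2 * Fintype.card σ * degreeOf k f := by
  have hterm (τ : Equiv.Perm σ) : (∑ i, degreeOf k
      (f * pderiv (τ i) (pderiv i f) - pderiv (τ i) f * pderiv i f)) + 2
      ≤ 2 * Fintype.card σ * degreeOf k f := by
    have hsum := Finset.sum_le_sum fun i (_ : i ∈ Finset.univ) =>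
      degreeOf_hessianLog_add_le h (τ i) i
    have hτ : ∑ i, (if τ i = k then 1 else 0) = 1 := by
      rw [Equiv.sum_comp τ fun i => if i = k then 1 else 0]
      simp
    simp only [Finset.sum_add_distrib, hτ, Finset.sum_ite_eq', Finset.mem_univ, if_true,
      Finset.sum_const, Finset.card_univ, smul_eq_mul] at hsum
    linarith
  have h2 := hterm 1
  refine (Nat.le_sub_iff_add_le (by omega)).mp ?_
  rw [Matrix.det_apply']
  refine (degreeOf_sum_le _ _ _).trans (Finset.sup_le fun τ _ => ?_)
  have hprod := degreeOf_prod_le k Finset.univ fun i =>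
    f * pderiv (τ i) (pderiv i f) - pderiv (τ i) f * pderiv i f
  have hτ := hterm τ
  simp only [Matrix.of_apply]
  obtain hsign | hsign := Int.units_eq_one_or (Equiv.Perm.sign τ)
  · simp only [hsign, Units.val_one, Int.cast_one, one_mul]
    omega
  · simp only [hsign, Units.val_neg, Units.val_one, Int.cast_neg, Int.cast_one, neg_one_mul,
      degreeOf_neg]
    omega

theorem degreeOf_hessianLog_self [IsDomain R] [CharZero R] {k : σ} {f : MvPolynomial σ R}
    (h : 1 ≤ degreeOf k f) :
    degreeOf k (f * pderiv k (pderiv k f) - pderiv k f * pderiv k f)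
      = 2 * degreeOf k f - 2 := by
  set d := degreeOf k f with hd
  set T := f * pderiv k (pderiv k f) - pderiv k f * pderiv k f with hT
  set g := X k * pderiv k f - C (d : R) * f with hg
  have hgd : degreeOf k g < d := degreeOf_X_mul_pderiv_sub_lt h
  have hf : f ≠ 0 := by
    rintro rfl
    simp at hd
    omega
  have hd0 : C (-(d : R)) ≠ (0 : MvPolynomial σ R) := by
    rw [Ne, C_eq_zero, neg_eq_zero, Nat.cast_eq_zero]
    omega
  have hfg : X k * pderiv k f = C (d : R) * f + g := by rw [hg]; ring
  set r := f * (X k * pderiv k g - C ((d : R) + 1) * g) - g * g with hr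
  have key : T * X k ^ 2 = C (-(d : R)) * (f * f) + r := by
    have hder := congrArg (pderiv k) hfg
    simp only [pderiv_mul, map_add, pderiv_X_self, pderiv_C, zero_mul, zero_add, one_mul] at hder
    simp only [hT, hr, map_neg, map_add, map_one]
    linear_combination (X k * f) * hder - (X k * pderiv k f + C (d : R) * f + g) * hfg
      + (C (d : R) - 1) * f * hfg
  have hlead : degreeOf k (C (-(d : R)) * (f * f)) = 2 * d := by
    rw [degreeOf_mul_eq hd0 (mul_ne_zero hf hf), degreeOf_mul_eq hf hf, degreeOf_C]
    omega
  have hrd : degreeOf k r < 2 * d := by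
    have h1 := degreeOf_sub_le k (f * (X k * pderiv k g - C ((d : R) + 1) * g)) (g * g)
    rw [← hr] at h1
    have h2 := degreeOf_mul_le k f (X k * pderiv k g - C ((d : R) + 1) * g)
    have h3 := degreeOf_sub_le k (X k * pderiv k g) (C ((d : R) + 1) * g)
    have h4 := degreeOf_X_mul_pderiv_le k g
    have h5 := degreeOf_C_mul_le g k ((d : R) + 1)
    have h6 := degreeOf_mul_le k g g
    omega
  have hdeg : degreeOf k (T * X k ^ 2) = 2 * d := by
    rw [key, degreeOf_add_eq_of_degreeOf_lt (by rwa [hlead]), hlead]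
  have hT0 : T ≠ 0 := by
    rintro h0
    rw [h0, zero_mul, degreeOf_zero] at hdeg
    omega
  rw [degreeOf_mul_X_self_pow_eq_add_of_ne_zero k 2 hT0] at hdeg
  omega

end CommRing

end MvPolynomial

/-- Here `T_{ij} := F·F_{ij} − F_i·F_j`. -/
theorem statement13 (N : ℕ) (F : MvPolynomial (Fin N) ℝ) (k : Fin N)
    (hdeg : 1 ≤ F.degreeOf k) :
    -- (a)
    (degreeOf k (F * pderiv k (pderiv k F) - pderiv k F * pderiv k F)
        = 2 * F.degreeOf k - 2) ∧
    -- (b)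
    (∀ j, j ≠ k →
      degreeOf k (F * pderiv k (pderiv j F) - pderiv k F * pderiv j F)
        ≤ 2 * F.degreeOf k - 1) ∧
    (∀ j, j ≠ k →
      degreeOf k (F * pderiv j (pderiv k F) - pderiv j F * pderiv k F)
        ≤ 2 * F.degreeOf k - 1) ∧
    -- (c)
    (∀ i j, i ≠ k → j ≠ k →
      degreeOf k (F * pderiv i (pderiv j F) - pderiv i F * pderiv j F)
        ≤ 2 * F.degreeOf k) ∧
    -- (d)
    degreeOf k (Matrix.det (Matrix.of fun i j : Fin N =>
        F * pderiv i (pderiv j F) - pderiv i F * pderiv j F))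
      ≤ 2 * N * F.degreeOf k - 2 := by
  refine ⟨degreeOf_hessianLog_self hdeg, fun j hj => ?_, fun j hj => ?_, fun i j hi hj => ?_, ?_⟩
  · have h := degreeOf_hessianLog_add_le hdeg k j
    simp only [if_true, if_neg hj] at h
    omega
  · have h := degreeOf_hessianLog_add_le hdeg j k
    simp only [if_true, if_neg hj] at h
    omega
  · have h := degreeOf_hessianLog_add_le hdeg i j
    omega
  · have h := degreeOf_det_hessianLog_add_two_le hdeg
    rw [Fintype.card_fin] at h
    omega
end

section
/- Let E₁, …, E_n be nonzero positive semidefinite real symmetric g×g matrices such that Σ_j c_j·E_j is positive definite for some c ∈ ℝⁿ (so that M(x) := Σ_j x_j·E_j is a logarithmical positive matrix function). Then for each index i, the degree of S(x) := det(Σ_j x_j E_j) in the variable x_i equals rank(E_i); moreover, writing S = S_i·x_i^{rank E_i} + (terms of lower degree in x_i), the leading coefficient S_i is a homogeneous polynomial of degree g − rank(E_i) in the remaining n−1 variables. -/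
open Matrix MvPolynomial

section MvPolynomialAux

variable {σ R : Type*} [CommRing R]

/-- Splitting off the top power of one variable of a nonzero homogeneous polynomial. -/
theorem MvPolynomial.IsHomogeneous.exists_leading_coeff_degreeOf
    {p : MvPolynomial σ R} {d : ℕ} (hp : p.IsHomogeneous d) (hp0 : p ≠ 0) (i : σ) :
    ∃ q r : MvPolynomial σ R,
      p = q * X i ^ degreeOf i p + r ∧ degreeOf i q = 0 ∧ q ≠ 0 ∧
      q.IsHomogeneous (d - degreeOf i p) ∧ (r = 0 ∨ degreeOf i r < degreeOf i p) := by
  classical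
  set k := degreeOf i p with hk
  have hadd : p = divMonomial p (Finsupp.single i k) * X i ^ k +
      modMonomial p (Finsupp.single i k) := by
    conv_lhs => rw [← divMonomial_add_modMonomial p (Finsupp.single i k)]
    rw [X_pow_eq_monomial, mul_comm]
  have hr : ∀ m ∈ (modMonomial p (Finsupp.single i k)).support, m i < k := by
    intro m hm
    rw [mem_support_iff] at hm
    by_contra! hlt
    exact hm (coeff_modMonomial_of_le _ (Finsupp.single_le_iff.2 hlt))
  have hr' : modMonomial p (Finsupp.single i k) = 0 ∨
      degreeOf i (modMonomial p (Finsupp.single i k)) < k := by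
    rw [or_iff_not_imp_left]
    intro h
    obtain ⟨m, hm⟩ := support_nonempty.2 h
    exact (degreeOf_lt_iff (Nat.zero_lt_of_lt (hr m hm))).2 hr
  refine ⟨_, _, hadd, ?_, ?_, ?_, hr'⟩
  · rw [← Nat.le_zero, degreeOf_le_iff]
    intro m hm
    rw [mem_support_iff, coeff_divMonomial] at hm
    have := monomial_le_degreeOf i (mem_support_iff.2 hm)
    simp only [Finsupp.add_apply, Finsupp.single_eq_same] at this
    omega
  · intro h
    rw [h, zero_mul, zero_add] at hadd
    rw [← hadd] at hr'
    exact hr'.elim hp0 (lt_irrefl _)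
  · intro m hm
    rw [coeff_divMonomial] at hm
    have := hp hm
    rw [map_add, Finsupp.weight_single] at this
    simp only [Pi.one_apply, smul_eq_mul, mul_one] at this
    omega

/-- Substituting univariate polynomials that are constant except for a linear one at `i`. -/
theorem MvPolynomial.natDegree_aeval_le_degreeOf (p : MvPolynomial σ R) (i : σ)
    (f : σ → Polynomial R) (hi : (f i).natDegree ≤ 1) (hf : ∀ j ≠ i, (f j).natDegree = 0) :
    (aeval f p).natDegree ≤ degreeOf i p := by
  classical
  rw [aeval_def, eval₂_eq]
  refine Polynomial.natDegree_sum_le_of_forall_le _ _ fun m hm => ?_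
  refine (Polynomial.natDegree_C_mul_le _ _).trans ?_
  refine (Polynomial.natDegree_prod_le _ _).trans ?_
  refine le_trans ?_ (monomial_le_degreeOf i hm)
  calc ∑ j ∈ m.support, (f j ^ m j).natDegree
      ≤ ∑ j ∈ m.support, if j = i then m j else 0 := by
        refine Finset.sum_le_sum fun j _ => Polynomial.natDegree_pow_le.trans ?_
        split_ifs with h
        · subst h
          exact (Nat.mul_le_mul_left _ hi).trans (by simp)
        · simp [hf j h]
    _ ≤ m i := by
        rw [Finset.sum_ite_eq']
        split_ifs <;> simp

end MvPolynomialAux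

section Pencil

variable {ι κ R : Type*} [Fintype ι] [Fintype κ] [CommRing R]

/-- The linear matrix pencil `∑ j, x j • E j` over the polynomial ring. -/
noncomputable def linearPencil (E : κ → Matrix ι ι R) : Matrix ι ι (MvPolynomial κ R) :=
  Matrix.of fun a b => ∑ j, C (E j a b) * X j

theorem linearPencil_conj (E : κ → Matrix ι ι R) (P Q : Matrix ι ι R) :
    linearPencil (fun j => P * E j * Q) =
      P.map (C : R →+* MvPolynomial κ R) * linearPencil E * Q.map (C : R →+* _) := by
  have h : ∀ F : κ → Matrix ι ι R,
      linearPencil F = ∑ j, (X j : MvPolynomial κ R) • (F j).map (C : R →+* _) := by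
    intro F
    ext1 a b
    simp [linearPencil, Matrix.sum_apply, mul_comm]
  rw [h, h, Matrix.mul_sum, Matrix.sum_mul]
  refine Finset.sum_congr rfl fun j _ => ?_
  rw [Matrix.map_mul, Matrix.map_mul, Matrix.mul_smul, Matrix.smul_mul]

variable [DecidableEq ι]

theorem isHomogeneous_det_linearPencil (E : κ → Matrix ι ι R) :
    (linearPencil E).det.IsHomogeneous (Fintype.card ι) := by
  rw [det_apply']
  refine IsHomogeneous.sum _ _ _ fun s _ => ?_
  rw [← map_intCast (C : R →+* MvPolynomial κ R)]
  refine IsHomogeneous.C_mul ?_ _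
  have := IsHomogeneous.prod (Finset.univ : Finset ι) (fun a => linearPencil E (s a) a)
    (fun _ => 1) fun a _ => IsHomogeneous.sum _ _ _ fun j _ =>
      (isHomogeneous_X R j).C_mul (E j (s a) a)
  simpa using this

theorem det_linearPencil_conj (E : κ → Matrix ι ι R) (P Q : Matrix ι ι R) :
    (linearPencil (fun j => P * E j * Q)).det = C (P.det * Q.det) * (linearPencil E).det := by
  have h : ∀ A : Matrix ι ι R, (A.map (C : R →+* MvPolynomial κ R)).det = C A.det :=
    fun A => (RingHom.map_det (C : R →+* MvPolynomial κ R) A).symm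
  rw [linearPencil_conj, det_mul, det_mul, h, h, map_mul]
  ring

theorem aeval_det_linearPencil {A : Type*} [CommRing A] [Algebra R A] (E : κ → Matrix ι ι R)
    (f : κ → A) :
    aeval f (linearPencil E).det = (∑ j, f j • (E j).map (algebraMap R A)).det := by
  rw [AlgHom.map_det]
  congr 1
  ext a b
  simp [linearPencil, Matrix.sum_apply, mul_comm]

theorem degreeOf_det_linearPencil_le (E : κ → Matrix ι ι R) (i : κ) (d : ι → R)
    [DecidableEq R] (hd : E i = diagonal d) :
    degreeOf i (linearPencil E).det ≤ Fintype.card {a // d a ≠ 0} := by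
  classical
  have hentry : ∀ a b, degreeOf i (linearPencil E a b) ≤ if d b ≠ 0 then 1 else 0 := by
    intro a b
    refine (degreeOf_sum_le _ _ _).trans (Finset.sup_le fun j _ => ?_)
    by_cases hj : j = i
    · subst hj
      by_cases hb : d b = 0
      · have : E j a b = 0 := by
          rw [hd, diagonal_apply]
          split_ifs with hab
          · rw [hab, hb]
          · rfl
        simp [this]
      · rw [if_pos hb]
        refine (degreeOf_C_mul_le _ _ _).trans ?_
        have := nontrivial_of_ne _ _ hb
        simp
    · refine (degreeOf_C_mul_le _ _ _).trans ?_
      simp [degreeOf_X_of_ne (R := R) (Ne.symm hj)]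
  rw [det_apply']
  refine (degreeOf_sum_le _ _ _).trans (Finset.sup_le fun s _ => ?_)
  rw [← map_intCast (C : R →+* MvPolynomial κ R)]
  refine (degreeOf_C_mul_le _ _ _).trans ((degreeOf_prod_le _ _ _).trans ?_)
  refine (Finset.sum_le_sum fun a _ => hentry (s a) a).trans ?_
  rw [Fintype.card_subtype, Finset.card_filter]

theorem degreeOf_det_linearPencil_of_diagonal [IsDomain R] [DecidableEq R]
    (E : κ → Matrix ι ι R) (i : κ) (d : ι → R) (hd : E i = diagonal d) (c : κ → R)
    (hc : ∑ j, c j • E j = 1) :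
    degreeOf i (linearPencil E).det = Fintype.card {a // d a ≠ 0} := by
  classical
  refine le_antisymm (degreeOf_det_linearPencil_le E i d hd) ?_
  let f : κ → Polynomial R := fun j => Polynomial.C (c j) + if j = i then Polynomial.X else 0
  have hsum : ∑ j, f j • (E j).map (algebraMap R (Polynomial R)) =
      diagonal fun a => Polynomial.C (d a) * Polynomial.X + Polynomial.C 1 := by
    have h1 : ∑ j, Polynomial.C (c j) • (E j).map (algebraMap R (Polynomial R)) = 1 := by
      have := congrArg (fun M : Matrix ι ι R => M.map (algebraMap R (Polynomial R))) hc
      ext1 a b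
      have := congrFun (congrFun this a) b
      simpa [Matrix.sum_apply, Matrix.one_apply, apply_ite] using this
    have h2 : ∑ j, (if j = i then Polynomial.X else 0 : Polynomial R) •
        (E j).map (algebraMap R (Polynomial R)) =
        (Polynomial.X : Polynomial R) • (E i).map (algebraMap R (Polynomial R)) := by
      simp [ite_smul]
    simp only [f, add_smul, Finset.sum_add_distrib]
    rw [h1, h2, hd]
    ext1 a b
    by_cases hab : a = b
    · subst hab
      simp only [Matrix.add_apply, Matrix.smul_apply, map_apply, diagonal_apply_eq, one_apply_eq,
        smul_eq_mul, Polynomial.algebraMap_eq, map_one]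
      ring
    · simp [hab]
  have hdeg := natDegree_aeval_le_degreeOf (linearPencil E).det i f
    (by simp [f]) (fun j hj => by simp [f, hj])
  rw [aeval_det_linearPencil, hsum, det_diagonal, Polynomial.natDegree_prod] at hdeg
  · refine le_trans (le_of_eq ?_) hdeg
    rw [Fintype.card_subtype, Finset.card_filter]
    refine Finset.sum_congr rfl fun a _ => ?_
    by_cases ha : d a = 0
    · simp [ha]
    · rw [if_pos ha, Polynomial.natDegree_linear ha]
  · intro a _ h
    simpa using congrArg (Polynomial.eval 0) h

end Pencil

open scoped MatrixOrder Matrix.Norms.L2Operator in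
/-- Simultaneous diagonalization by congruence of a positive definite and a symmetric matrix. -/
theorem Matrix.PosDef.exists_simultaneous_diagonal {ι : Type*} [Fintype ι] [DecidableEq ι]
    {P A : Matrix ι ι ℝ} (hP : P.PosDef) (hA : A.IsHermitian) :
    ∃ (Q : Matrix ι ι ℝ) (d : ι → ℝ), IsUnit Q.det ∧ Qᴴ * P * Q = 1 ∧ Qᴴ * A * Q = diagonal d := by
  obtain ⟨Q, hQ, hPQ⟩ : ∃ Q : Matrix ι ι ℝ, IsUnit Q.det ∧ Qᴴ * P * Q = 1 := by
    obtain ⟨B, hB⟩ := CStarAlgebra.nonneg_iff_eq_star_mul_self.mp hP.posSemidef.nonneg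
    rw [star_eq_conjTranspose] at hB
    have hBdet : IsUnit B.det := by
      have := (isUnit_iff_isUnit_det _).1 hP.isUnit
      rw [hB, det_mul] at this
      exact isUnit_of_mul_isUnit_right this
    refine ⟨B⁻¹, (isUnit_nonsing_inv_det_iff).2 hBdet, ?_⟩
    have h1 : (B⁻¹)ᴴ * Bᴴ = 1 := by
      rw [← conjTranspose_mul, mul_nonsing_inv _ hBdet, conjTranspose_one]
    rw [hB, ← Matrix.mul_assoc, h1, Matrix.one_mul, mul_nonsing_inv _ hBdet]
  have hH : (Qᴴ * A * Q).IsHermitian := isHermitian_conjTranspose_mul_mul Q hA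
  set U : Matrix ι ι ℝ := hH.eigenvectorUnitary.1
  have hUU : Uᴴ * U = 1 := Unitary.coe_star_mul_self hH.eigenvectorUnitary
  have hUdet : IsUnit U.det := by
    have := congrArg det hUU
    rw [det_mul, det_one] at this
    exact IsUnit.of_mul_eq_one_right _ this
  have hspec : Qᴴ * A * Q = U * diagonal hH.eigenvalues * Uᴴ := by
    have := hH.spectral_theorem
    rwa [Unitary.conjStarAlgAut_apply] at this
  have hconj : ∀ M : Matrix ι ι ℝ, (Q * U)ᴴ * M * (Q * U) = Uᴴ * (Qᴴ * M * Q) * U := by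
    intro M
    simp only [conjTranspose_mul, Matrix.mul_assoc]
  refine ⟨Q * U, hH.eigenvalues, ?_, ?_, ?_⟩
  · rw [det_mul]
    exact hQ.mul hUdet
  · rw [hconj, hPQ, Matrix.mul_one, hUU]
  · calc (Q * U)ᴴ * A * (Q * U) = (Uᴴ * U) * diagonal hH.eigenvalues * (Uᴴ * U) := by
          rw [hconj]
          refine (congrArg (fun M => Uᴴ * M * U) hspec).trans ?_
          simp only [Matrix.mul_assoc]
      _ = diagonal hH.eigenvalues := by rw [hUU, Matrix.one_mul, Matrix.mul_one]

theorem det_linearPencil_ne_zero {ι κ : Type*} [Fintype ι] [DecidableEq ι] [Fintype κ]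
    (E : κ → Matrix ι ι ℝ) {c : κ → ℝ} (hc : (∑ j, c j • E j).PosDef) :
    (linearPencil E).det ≠ 0 := by
  intro h
  have := aeval_det_linearPencil E c
  rw [h, map_zero] at this
  refine hc.det_pos.ne ?_
  simpa using this

/-- The degree of the determinant of a linear pencil with a positive definite value in a variable
is the rank of the corresponding symmetric coefficient. -/
theorem degreeOf_det_linearPencil_eq_rank {ι κ : Type*} [Fintype ι] [DecidableEq ι] [Fintype κ]
    (E : κ → Matrix ι ι ℝ) {c : κ → ℝ} (hc : (∑ j, c j • E j).PosDef) (i : κ)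
    (hE : (E i).IsHermitian) :
    degreeOf i (linearPencil E).det = (E i).rank := by
  classical
  obtain ⟨Q, d, hQ, hP, hd⟩ := hc.exists_simultaneous_diagonal hE
  have hQ' : IsUnit Qᴴ.det := by
    rw [det_conjTranspose]
    exact hQ.star
  have hsum : ∑ j, c j • (Qᴴ * E j * Q) = 1 := by
    rw [← hP, Matrix.mul_sum, Matrix.sum_mul]
    simp
  have h := degreeOf_det_linearPencil_of_diagonal (fun j => Qᴴ * E j * Q) i d hd c hsum
  rw [det_linearPencil_conj,
    degreeOf_C_mul _ _ (mem_nonZeroDivisors_of_ne_zero (hQ'.mul hQ).ne_zero)] at h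
  rw [h, ← rank_diagonal, ← hd, rank_mul_eq_left_of_isUnit_det _ _ hQ,
    rank_mul_eq_right_of_isUnit_det _ _ hQ']

theorem statement14 (g n : ℕ) (hg : 0 < g)
    (E : Fin n → Matrix (Fin g) (Fin g) ℝ)
    (hne : ∀ j, E j ≠ 0)
    (hpsd : ∀ j, (E j).PosSemidef)
    (hpd : ∃ c : Fin n → ℝ, (∑ j, c j • E j).PosDef)
    (i : Fin n) :
    degreeOf i (Matrix.det (Matrix.of fun a b : Fin g =>
        ∑ j, C (E j a b) * X j)) = (E i).rank ∧
    ∃ Si R : MvPolynomial (Fin n) ℝ,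
      Matrix.det (Matrix.of fun a b : Fin g => ∑ j, C (E j a b) * X j)
          = Si * X i ^ (E i).rank + R ∧
      degreeOf i Si = 0 ∧
      Si ≠ 0 ∧
      Si.IsHomogeneous (g - (E i).rank) ∧
      (R = 0 ∨ degreeOf i R < (E i).rank) := by
  obtain ⟨c, hc⟩ := hpd
  have hdeg := degreeOf_det_linearPencil_eq_rank E hc i (hpsd i).isHermitian
  have hhom := isHomogeneous_det_linearPencil E
  rw [Fintype.card_fin] at hhom
  refine ⟨hdeg, ?_⟩
  have := hhom.exists_leading_coeff_degreeOf (det_linearPencil_ne_zero E hc) i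
  rwa [hdeg] at this
end

section
/- Let E₁, …, E_n be nonzero positive semidefinite real symmetric g×g matrices such that Σ_j c_j·E_j is positive definite for some c ∈ ℝⁿ. Fix i, let r := rank(E_i), and choose an orthogonal matrix O with Oᵀ·E_i·O = diag(λ₁, …, λ_r, 0, …, 0), λ₁ ≥ … ≥ λ_r > 0. For j ≠ i let E_j^{(i)} denote the lower-right (g−r)×(g−r) block of Oᵀ·E_j·O. Then the coefficient S_i of x_i^r in det(Σ_j x_j E_j) equals (λ₁⋯λ_r) · det(Σ_{j≠i} x_j·E_j^{(i)}) as a polynomial in the variables x_j (j ≠ i); moreover, for every c ∈ ℝⁿ with Σ_j c_j·E_j positive definite, the matrix Σ_{j≠i} c_j·E_j^{(i)} is positive definite, so in particular S_i(c) > 0. -/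
open Matrix MvPolynomial

/-- The lower-right `(g-r)×(g-r)` block of a `g×g` matrix. -/
def lowerBlock (g r : ℕ) (M : Matrix (Fin g) (Fin g) ℝ) :
    Matrix (Fin (g - r)) (Fin (g - r)) ℝ :=
  Matrix.of fun a b =>
    M ⟨r + a.val, by have := a.isLt; omega⟩ ⟨r + b.val, by have := b.isLt; omega⟩

lemma degreeOf_det_eq_zero {σ R m : Type*} [CommRing R] [Fintype m] [DecidableEq m]
    {i : σ} {N : Matrix m m (MvPolynomial σ R)} (hN : ∀ a b, degreeOf i (N a b) = 0) :
    degreeOf i N.det = 0 := by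
  rw [det_apply']
  refine Nat.le_zero.mp ((degreeOf_sum_le _ _ _).trans (Finset.sup_le fun τ _ => ?_))
  have hsign : ((Equiv.Perm.sign τ : ℤ) : MvPolynomial σ R)
      = C ((Equiv.Perm.sign τ : ℤ) : R) := by simp
  rw [hsign]
  refine (degreeOf_C_mul_le _ _ _).trans ((degreeOf_prod_le _ _ _).trans ?_)
  simp [hN]

/-- If `d` vanishes outside `p` and `N` does not involve `X i`, the coefficient of the top possible
power of `X i` in `det (X i • diagonal d + N)` is the product of the `d a` with `p a` times the
complementary principal minor of `N`. -/
lemma exists_det_X_smul_diagonal_add {σ R m : Type*} [CommRing R] [Nontrivial R]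
    [Fintype m] [DecidableEq m] (i : σ) (p : m → Prop) [DecidablePred p] (d : m → R)
    (hd : ∀ a, ¬p a → d a = 0) (N : Matrix m m (MvPolynomial σ R))
    (hN : ∀ a b, degreeOf i (N a b) = 0) :
    ∃ Q : MvPolynomial σ R,
      ((X i : MvPolynomial σ R) • diagonal (fun a => C (d a)) + N).det
        = C (∏ a ∈ Finset.univ.filter p, d a) * (N.toSquareBlockProp fun a => ¬p a).det
          * X i ^ (Finset.univ.filter p).card + Q ∧
      (Q = 0 ∨ degreeOf i Q < (Finset.univ.filter p).card) := by
  set D : Matrix m m (MvPolynomial σ R) := diagonal (fun a => C (d a)) with hD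
  set S : Finset m := Finset.univ.filter p with hS
  let P : Finset m → Matrix m m (MvPolynomial σ R) := fun s =>
    of fun a b => if a ∈ s then D a b else N a b
  have hterm (s : Finset m) :
      detRowAlternating (s.piecewise (fun a => (X i : MvPolynomial σ R) • D.row a) N.row)
        = X i ^ s.card * (P s).det := by
    have h := MultilinearMap.map_piecewise_smul
      (detRowAlternating (n := m) (R := MvPolynomial σ R)).toMultilinearMap
      (fun _ => (X i : MvPolynomial σ R)) (P s).row s
    rw [Finset.prod_const, smul_eq_mul] at h
    refine Eq.trans ?_ h
    refine congrArg detRowAlternating (funext fun a => ?_)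
    by_cases ha : a ∈ s
    · rw [Finset.piecewise_eq_of_mem _ _ _ ha, Finset.piecewise_eq_of_mem _ _ _ ha]
      ext1 b
      simp [P, ha, row]
    · rw [Finset.piecewise_eq_of_notMem _ _ _ ha, Finset.piecewise_eq_of_notMem _ _ _ ha]
      ext1 b
      simp [P, ha, row]
  have hsum : ((X i : MvPolynomial σ R) • D + N).det
      = ∑ s : Finset m, X i ^ s.card * (P s).det := by
    simp only [← hterm]
    exact (detRowAlternating (n := m) (R := MvPolynomial σ R)).map_add_univ _ _
  have htop : (P S).det = C (∏ a ∈ S, d a) * (N.toSquareBlockProp fun a => ¬p a).det := by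
    rw [twoBlockTriangular_det' _ p]
    · congr 1
      · have h : (P S).toSquareBlockProp p = diagonal fun a : {a // p a} => C (d a) := by
          ext1 a b
          simp [toSquareBlockProp_def, P, hS, hD, a.2, diagonal_apply, Subtype.ext_iff]
        rw [h, det_diagonal, map_prod, hS, Finset.prod_subtype (p := p) _ (by simp)]
      · congr 1
        ext1 a b
        simp [toSquareBlockProp_def, P, hS, a.2]
    · intro a ha b hb
      have hab : a ≠ b := fun h => hb (h ▸ ha)
      simp [P, hS, hD, ha, hab]
  refine ⟨∑ s ∈ Finset.univ.erase S, X i ^ s.card * (P s).det, ?_, ?_⟩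
  · rw [hsum, ← Finset.add_sum_erase _ _ (Finset.mem_univ S), htop, mul_comm (X i ^ S.card)]
  · refine Finset.sum_induction _ (fun q => q = 0 ∨ degreeOf i q < S.card) ?_ (Or.inl rfl) ?_
    · rintro x y (rfl | hx) (rfl | hy)
      · simp
      · simp [hy]
      · simp [hx]
      · exact Or.inr ((degreeOf_add_le _ _ _).trans_lt (max_lt hx hy))
    · intro s hs
      by_cases hsS : s ⊆ S
      · refine Or.inr ?_
        have hcard := Finset.card_lt_card (hsS.ssubset_of_ne (Finset.ne_of_mem_erase hs))
        refine (degreeOf_mul_le _ _ _).trans_lt ?_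
        rw [degreeOf_X_self_pow, degreeOf_det_eq_zero, add_zero]
        · exact hcard
        · intro a b
          by_cases ha : a ∈ s
          · by_cases hab : a = b
            · subst hab
              simp [P, ha, hD]
            · simp [P, hD, hab, ha]
          · simpa [P, ha] using hN a b
      · obtain ⟨a, ha, haS⟩ := Finset.not_subset.mp hsS
        have hda : d a = 0 := hd a (by simpa [hS] using haS)
        refine Or.inl ?_
        rw [det_eq_zero_of_row_eq_zero a, mul_zero]
        intro b
        simp [P, ha, hD, hda, diagonal_apply]

/-- The indices of `Fin g` that are at least `r`, shifted down by `r`. -/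
def finNotLtEquiv (g r : ℕ) : {a : Fin g // ¬(a : ℕ) < r} ≃ Fin (g - r) where
  toFun a := ⟨a.1 - r, by have := a.1.isLt; have := a.2; omega⟩
  invFun a := ⟨⟨r + a, by have := a.isLt; omega⟩, by simp⟩
  left_inv a := by
    have := a.2
    ext
    simp only
    omega
  right_inv a := by
    ext
    simp

lemma lowerBlock_eq_submatrix (g r : ℕ) (M : Matrix (Fin g) (Fin g) ℝ) :
    lowerBlock g r M = M.submatrix (fun a => ((finNotLtEquiv g r).symm a : Fin g))
      (fun a => ((finNotLtEquiv g r).symm a : Fin g)) := rfl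

/-- The top coefficient in `X i` of the determinant of the pencil `∑ j, X j • E j`, when `E i` is
orthogonally diagonalized with eigenvalues vanishing from index `r` on. -/
lemma exists_det_pencil_eq {g n r : ℕ} (E : Fin n → Matrix (Fin g) (Fin g) ℝ) (i : Fin n)
    {O : Matrix (Fin g) (Fin g) ℝ} (hO : Oᵀ * O = 1) {lam : Fin g → ℝ}
    (hdiag : Oᵀ * E i * O = diagonal lam) (hrg : r ≤ g)
    (hlam_zero : ∀ a : Fin g, r ≤ (a : ℕ) → lam a = 0) :
    ∃ Q : MvPolynomial (Fin n) ℝ,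
      det (of fun a b : Fin g => ∑ j, C (E j a b) * X j)
        = (C (∏ a ∈ Finset.univ.filter (fun a : Fin g => (a : ℕ) < r), lam a)
            * det (of fun a b : Fin (g - r) =>
                ∑ j ∈ Finset.univ.erase i, C (lowerBlock g r (Oᵀ * E j * O) a b) * X j))
          * X i ^ r + Q ∧
      (Q = 0 ∨ degreeOf i Q < r) := by
  have hcard : (Finset.univ.filter fun a : Fin g => (a : ℕ) < r).card = r := by
    rw [Fin.card_filter_val_lt]
    exact min_eq_right hrg
  have hOO : O * Oᵀ = 1 := mul_eq_one_comm.mp hO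
  let N : Matrix (Fin g) (Fin g) (MvPolynomial (Fin n) ℝ) :=
    of fun a b => ∑ j ∈ Finset.univ.erase i, C ((Oᵀ * E j * O) a b) * X j
  have hN : ∀ a b, degreeOf i (N a b) = 0 := by
    intro a b
    simp only [N, of_apply]
    refine Nat.le_zero.mp ((degreeOf_sum_le _ _ _).trans (Finset.sup_le fun j hj => ?_))
    rw [degreeOf_mul_X_of_ne _ (Finset.ne_of_mem_erase hj).symm, degreeOf_C]
  obtain ⟨Q, hQ, hdeg⟩ := exists_det_X_smul_diagonal_add i (fun a : Fin g => (a : ℕ) < r) lam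
    (fun a ha => hlam_zero a (not_lt.mp ha)) N hN
  rw [hcard] at hQ hdeg
  refine ⟨Q, ?_, hdeg⟩
  have hpencil (F : Fin n → Matrix (Fin g) (Fin g) ℝ) :
      (of fun a b : Fin g => ∑ j, C (F j a b) * X j : Matrix _ _ (MvPolynomial (Fin n) ℝ))
        = ∑ j, (X j : MvPolynomial (Fin n) ℝ) • (F j).map C := by
    ext1 a b
    simp [Matrix.sum_apply, mul_comm]
  have hdet : (O.map (C : ℝ →+* MvPolynomial (Fin n) ℝ)).det
      * (Oᵀ.map (C : ℝ →+* MvPolynomial (Fin n) ℝ)).det = 1 := by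
    rw [← det_mul, ← Matrix.map_mul, hOO, Matrix.map_one _ (map_zero _) (map_one _), det_one]
  have hconj : (Oᵀ.map C) * (of fun a b : Fin g => ∑ j, C (E j a b) * X j) * (O.map C)
      = (X i : MvPolynomial (Fin n) ℝ) • diagonal (fun a => C (lam a)) + N := by
    have hsplit : (X i : MvPolynomial (Fin n) ℝ) • diagonal (fun a => C (lam a)) + N
        = of fun a b : Fin g => ∑ j, C ((Oᵀ * E j * O) a b) * X j := by
      ext1 a b
      rw [of_apply, ← Finset.add_sum_erase _ _ (Finset.mem_univ i), hdiag]
      by_cases hab : a = b <;> simp [N, hab, mul_comm]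
    rw [hsplit, hpencil, hpencil, Finset.mul_sum, Finset.sum_mul]
    refine Finset.sum_congr rfl fun j _ => ?_
    rw [Matrix.map_mul, Matrix.map_mul, Matrix.mul_smul, Matrix.smul_mul]
  have hblock : (N.toSquareBlockProp fun a : Fin g => ¬(a : ℕ) < r).det
      = (of fun a b : Fin (g - r) => ∑ j ∈ Finset.univ.erase i,
          C (lowerBlock g r (Oᵀ * E j * O) a b) * X j).det := by
    rw [← det_submatrix_equiv_self (finNotLtEquiv g r).symm]
    rfl
  rw [← hblock, ← hQ, ← hconj, det_mul, det_mul, mul_right_comm,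
    mul_comm (det (Oᵀ.map _)), hdet, one_mul]

theorem statement15 (g n : ℕ) (hg : 0 < g)
    (E : Fin n → Matrix (Fin g) (Fin g) ℝ)
    (hne : ∀ j, E j ≠ 0)
    (hpsd : ∀ j, (E j).PosSemidef)
    (hpd : ∃ c : Fin n → ℝ, (∑ j, c j • E j).PosDef)
    (i : Fin n)
    (O : Matrix (Fin g) (Fin g) ℝ) (hO : Oᵀ * O = 1)
    (lam : Fin g → ℝ)
    (hdiag : Oᵀ * E i * O = Matrix.diagonal lam)
    (hlam_pos : ∀ a : Fin g, (a : ℕ) < (E i).rank → 0 < lam a)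
    (hlam_zero : ∀ a : Fin g, (E i).rank ≤ (a : ℕ) → lam a = 0)
    (hlam_mono : ∀ a b : Fin g, a ≤ b → lam b ≤ lam a) :
    (∃ R : MvPolynomial (Fin n) ℝ,
      Matrix.det (Matrix.of fun a b : Fin g => ∑ j, C (E j a b) * X j)
          = (C (∏ a ∈ Finset.univ.filter (fun a : Fin g => (a : ℕ) < (E i).rank), lam a)
              * Matrix.det (Matrix.of fun a b : Fin (g - (E i).rank) =>
                  ∑ j ∈ Finset.univ.erase i,
                    C (lowerBlock g (E i).rank (Oᵀ * E j * O) a b) * X j))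
            * X i ^ (E i).rank + R ∧
      (R = 0 ∨ degreeOf i R < (E i).rank)) ∧
    (∀ c : Fin n → ℝ, (∑ j, c j • E j).PosDef →
      (∑ j ∈ Finset.univ.erase i, c j • lowerBlock g (E i).rank (Oᵀ * E j * O)).PosDef ∧
      0 < MvPolynomial.eval c
          (C (∏ a ∈ Finset.univ.filter (fun a : Fin g => (a : ℕ) < (E i).rank), lam a)
            * Matrix.det (Matrix.of fun a b : Fin (g - (E i).rank) =>
                ∑ j ∈ Finset.univ.erase i,
                  C (lowerBlock g (E i).rank (Oᵀ * E j * O) a b) * X j))) := by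
  set r := (E i).rank
  have hrg : r ≤ g := by simpa using (E i).rank_le_card_width
  have hOO : O * Oᵀ = 1 := mul_eq_one_comm.mp hO
  refine ⟨?_, fun c hc => ?_⟩
  · exact exists_det_pencil_eq E i hO hdiag hrg hlam_zero
  · have hinj : Function.Injective O.mulVec :=
      mulVec_injective_of_isUnit (IsUnit.of_mul_eq_one _ hOO)
    have hconj : (Oᵀ * (∑ j, c j • E j) * O).PosDef := by
      simpa using hc.conjTranspose_mul_mul_same hinj
    have hzero : lowerBlock g r (Oᵀ * E i * O) = 0 := by
      rw [hdiag]
      ext a b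
      have h : lam ⟨r + a, by have := a.isLt; omega⟩ = 0 := hlam_zero _ (by simp)
      simp [lowerBlock, diagonal_apply, h]
    have hblock : (∑ j ∈ Finset.univ.erase i, c j • lowerBlock g r (Oᵀ * E j * O)).PosDef := by
      have hsub := hconj.submatrix (e := fun a => ((finNotLtEquiv g r).symm a : Fin g))
        (Subtype.val_injective.comp (finNotLtEquiv g r).symm.injective)
      convert! hsub using 1
      rw [← zero_add (∑ j ∈ Finset.univ.erase i, _), ← smul_zero (c i), ← hzero,
        Finset.add_sum_erase _ (fun j => c j • lowerBlock g r (Oᵀ * E j * O)) (Finset.mem_univ i),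
        Finset.mul_sum, Finset.sum_mul]
      ext a b
      simp [Matrix.sum_apply, lowerBlock_eq_submatrix]
    refine ⟨hblock, ?_⟩
    rw [map_mul, eval_C, RingHom.map_det]
    refine mul_pos (Finset.prod_pos fun a ha => hlam_pos a (by simpa using ha)) ?_
    convert! hblock.det_pos using 2
    ext a b
    simp [Matrix.sum_apply, mul_comm]
end

section
/- Let M₁ be a positive definite and M₂ a positive semidefinite real symmetric n×n matrix. Then the polynomial p(t) := det(M₁ + t·M₂) has degree exactly rank(M₂) in t, its leading coefficient is positive, and p(t) > 0 for every real t ≥ 0. (This is the paper's lemma that the determinant of an ∞-positive matrix M₁ + (ν₀ − c)·M₂ is never zero and equals Σ_i c_i ν₀^i with c_{rank(M₂)} > 0.) -/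
open Matrix Polynomial

/-- The characteristic pencil polynomial `p(t) = det(M₁ + t·M₂)`. -/
noncomputable def pencilDet (n : ℕ) (M₁ M₂ : Matrix (Fin n) (Fin n) ℝ) :
    Polynomial ℝ :=
  Matrix.det (Matrix.of fun i j : Fin n =>
    Polynomial.C (M₁ i j) + Polynomial.C (M₂ i j) * Polynomial.X)

lemma Matrix.IsHermitian.det_one_add_smul {n : Type*} [Fintype n] [DecidableEq n]
    {N : Matrix n n ℝ} (hN : N.IsHermitian) (t : ℝ) :
    (1 + t • N).det = ∏ i, (1 + t * hN.eigenvalues i) := by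
  conv_lhs => rw [hN.spectral_theorem, Unitary.conjStarAlgAut_apply, mul_assoc, ← smul_mul_assoc,
    det_one_add_mul_comm, mul_smul_comm, mul_assoc, Unitary.coe_star_mul_self, mul_one]
  rw [← diagonal_one, ← diagonal_smul, diagonal_add, det_diagonal]
  simp

lemma eval_pencilDet {n : ℕ} (M₁ M₂ : Matrix (Fin n) (Fin n) ℝ) (t : ℝ) :
    (pencilDet n M₁ M₂).eval t = (M₁ + t • M₂).det := by
  rw [pencilDet, ← coe_evalRingHom, RingHom.map_det]
  congr 1
  ext i j
  simp only [RingHom.mapMatrix_apply, map_apply, of_apply, coe_evalRingHom, eval_add, eval_mul, eval_C,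
    eval_X, Matrix.add_apply, Matrix.smul_apply, smul_eq_mul, mul_comm t]

lemma exists_pencilDet_eq_prod {n : ℕ} {M₁ M₂ : Matrix (Fin n) (Fin n) ℝ}
    (h1 : M₁.PosDef) (h2 : M₂.PosSemidef) :
    ∃ d : Fin n → ℝ, (∀ i, 0 ≤ d i) ∧ Fintype.card {i // d i ≠ 0} = M₂.rank ∧
      pencilDet n M₁ M₂ = C M₁.det * ∏ i, (C (d i) * X + 1) := by
  obtain ⟨B, hB⟩ : ∃ B : Matrix (Fin n) (Fin n) ℝ, M₁ = Bᴴ * B := by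
    open scoped MatrixOrder in
    exact CStarAlgebra.nonneg_iff_eq_star_mul_self.mp h1.posSemidef.nonneg
  have hdet : IsUnit B.det := by
    have := h1.det_pos.ne'
    rw [hB, det_mul] at this
    exact (right_ne_zero_of_mul this).isUnit
  have hN := h2.conjTranspose_mul_mul_same B⁻¹
  have hM₂ : Bᴴ * (B⁻¹ᴴ * M₂ * B⁻¹) * B = M₂ := by
    rw [mul_assoc, mul_assoc, nonsing_inv_mul _ hdet, mul_one, ← mul_assoc,
      ← conjTranspose_mul, nonsing_inv_mul _ hdet, conjTranspose_one, one_mul]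
  refine ⟨hN.isHermitian.eigenvalues, hN.eigenvalues_nonneg, ?_, Polynomial.funext fun t ↦ ?_⟩
  · have hdet' : IsUnit (Bᴴ).det := by simpa [det_conjTranspose] using hdet
    rw [← hN.isHermitian.rank_eq_card_non_zero_eigs]
    conv_rhs => rw [← hM₂, rank_mul_eq_left_of_isUnit_det _ _ hdet,
      rank_mul_eq_right_of_isUnit_det _ _ hdet']
  · have hsum : M₁ + t • M₂ = Bᴴ * (1 + t • (B⁻¹ᴴ * M₂ * B⁻¹)) * B := by
      rw [mul_add, add_mul, mul_one, ← hB, mul_smul_comm, smul_mul_assoc, hM₂]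
    rw [eval_pencilDet, hsum, det_mul, det_mul, hN.isHermitian.det_one_add_smul, hB, det_mul]
    simp only [eval_mul, eval_C, eval_prod, eval_add, eval_X, eval_one, add_comm, mul_comm t]
    ring

theorem statement16 (n : ℕ) (M₁ M₂ : Matrix (Fin n) (Fin n) ℝ)
    (h1 : M₁.PosDef) (h2 : M₂.PosSemidef) :
    (pencilDet n M₁ M₂).natDegree = M₂.rank ∧
    0 < (pencilDet n M₁ M₂).leadingCoeff ∧
    ∀ t : ℝ, 0 ≤ t → 0 < (pencilDet n M₁ M₂).eval t := by
  obtain ⟨d, hd, hrank, hp⟩ := exists_pencilDet_eq_prod h1 h2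
  have hdeg (i) : (C (d i) * X + 1).natDegree = if d i ≠ 0 then 1 else 0 := by
    split_ifs with h
    · exact natDegree_linear h
    · simp [not_not.mp h]
  have hlead (i) : 0 < (C (d i) * X + 1).leadingCoeff := by
    rcases (hd i).eq_or_lt with h | h
    · simp [← h]
    · rwa [← C_1, leadingCoeff_linear h.ne']
  rw [hp]
  refine ⟨?_, ?_, fun t ht ↦ ?_⟩
  · rw [natDegree_C_mul h1.det_pos.ne',
      natDegree_prod _ _ fun i _ ↦ leadingCoeff_ne_zero.mp (hlead i).ne',
      Finset.sum_congr rfl fun i _ ↦ hdeg i, Finset.sum_boole, ← hrank, Fintype.card_subtype,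
      Nat.cast_id]
  · rw [leadingCoeff_mul, leadingCoeff_C, leadingCoeff_prod]
    exact mul_pos h1.det_pos (Finset.prod_pos fun i _ ↦ hlead i)
  · rw [eval_mul, eval_C, eval_prod]
    refine mul_pos h1.det_pos (Finset.prod_pos fun i _ ↦ ?_)
    have := mul_nonneg (hd i) ht
    simp only [eval_add, eval_mul, eval_C, eval_X, eval_one]
    positivity
end
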